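/- Assume α = 0 and that there exists a constant K > 0 such that Kξ + B(ξ) ∈ S_d^+ for every ξ ∈ S_d^+. Then for every u ∈ S_d^{++}: ∫_{{⟨ξ,u⟩>1}} log⟨ξ,u⟩ m(dξ) ≤ (K / (1 − e^{−1})) ∫_0^∞ F(ψ(s,u)) ds. In particular, taking u = 𝟙 (the d×d identity matrix), if ∫_0^∞ F(ψ(s,𝟙)) ds < ∞ then ∫_{{‖ξ‖>1}} log‖ξ‖ m(dξ) < ∞. -/

import Mathlib

open MeasureTheory Matrix Filter Topology
open scoped ENNReal

attribute [local instance] Matrix.frobeniusNormedAddCommGroup Matrix.frobeniusNormedSpace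

noncomputable section

/-- The space of real `d × d` matrices (the symmetric positive semidefinite ones are singled
out via `Matrix.PosSemidef`, which over `ℝ` includes symmetry). With the local Frobenius-norm
instance above, `‖·‖` is the Frobenius norm and `Matrix.trace (x * y)` is the associated trace
inner product. -/
abbrev Mat (d : ℕ) := Matrix (Fin d) (Fin d) ℝ

instance {d : ℕ} : MeasurableSpace (Mat d) :=
  (inferInstance : MeasurableSpace (Fin d → Fin d → ℝ))

variable {d : ℕ}

/-- The trace inner product `⟨x, y⟩ = tr (x y)`. -/
def trIP (x y : Mat d) : ℝ := (x * y).trace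

/-- The set `S_d^+ \ {0}` of nonzero symmetric positive semidefinite matrices. -/
def coneNZ (d : ℕ) : Set (Mat d) := {ξ | ξ.PosSemidef ∧ ξ ≠ 0}

/-- The (entrywise) integral `∫_{S_d^+ \ {0}} g(ξ) μ(dξ)` of a scalar function `g` against the
`S_d^+`-valued measure `μ(dξ) = ρ(ξ) ν(dξ)` represented by a base measure `ν` and a
matrix-valued density `ρ`. -/
def muInt (ν : Measure (Mat d)) (ρ : Mat d → Mat d) (g : Mat d → ℝ) : Mat d :=
  Matrix.of fun i j => ∫ ξ in coneNZ d, g ξ * ρ ξ i j ∂ν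

/-- `F(u) = ⟨b,u⟩ + ∫_{S_d^+ \ {0}} (1 - e^{-⟨u,ξ⟩}) m(dξ)`. -/
def Ffun (b : Mat d) (m : Measure (Mat d)) (u : Mat d) : ℝ :=
  trIP b u + ∫ ξ in coneNZ d, (1 - Real.exp (-(trIP u ξ))) ∂m

/-- `R(u) = -2uαu + Bᵀ(u) - ∫_{S_d^+ \ {0}} (e^{-⟨u,ξ⟩} - 1) μ(dξ)`, with `Bt = Bᵀ` and
`μ(dξ) = ρ(ξ) ν(dξ)`. -/
def Rfun (α : Mat d) (Bt : Mat d →L[ℝ] Mat d) (ν : Measure (Mat d)) (ρ : Mat d → Mat d)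
    (u : Mat d) : Mat d :=
  (-2 : ℝ) • (u * α * u) + Bt u - muInt ν ρ (fun ξ => Real.exp (-(trIP u ξ)) - 1)

/-- An admissible parameter set `(α, b, B, m, μ)`.  The `S_d^+`-valued σ-finite measure `μ` on
`S_d^+ \ {0}` is represented (via Radon–Nikodym) by its matrix-valued density `ρ` with respect
to a σ-finite base measure `ν`, so that `μ(dξ) = ρ(ξ) ν(dξ)` and
`tr(μ)(dξ) = tr(ρ(ξ)) ν(dξ)`; `Bt` denotes the adjoint `Bᵀ` of the linear drift `B` with
respect to the trace inner product.  Measures on `S_d^+ \ {0}` are realized as measures on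
matrix space, all integrals against them being taken over `coneNZ d`. -/
structure Admissible (d : ℕ) where
  /-- linear diffusion coefficient `α ∈ S_d^+` -/
  α : Mat d
  /-- constant drift `b ∈ S_d^+` -/
  b : Mat d
  /-- linear drift `B : S_d → S_d` -/
  B : Mat d →L[ℝ] Mat d
  /-- adjoint of the linear drift -/
  Bt : Mat d →L[ℝ] Mat d
  /-- constant jump term: a Borel measure `m` on `S_d^+ \ {0}` -/
  m : Measure (Mat d)
  /-- base measure of the linear jump coefficient `μ` -/
  ν : Measure (Mat d)
  /-- matrix-valued density of `μ` with respect to `ν` -/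
  ρ : Mat d → Mat d
  hα : α.PosSemidef
  hb : b.PosSemidef
  /-- `b ⪰ (d-1) α` -/
  hbα : (b - ((d : ℝ) - 1) • α).PosSemidef
  /-- `∫ (‖ξ‖ ∧ 1) m(dξ) < ∞` -/
  hm : IntegrableOn (fun ξ => min ‖ξ‖ 1) (coneNZ d) m
  hν : SigmaFinite ν
  hρmeas : Measurable ρ
  /-- `μ` is `S_d^+`-valued -/
  hρpsd : ∀ᵐ ξ ∂(ν.restrict (coneNZ d)), (ρ ξ).PosSemidef
  /-- `∫ ‖ξ‖ tr(μ)(dξ) < ∞` -/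
  hμint : IntegrableOn (fun ξ => ‖ξ‖ * (ρ ξ).trace) (coneNZ d) ν
  /-- `Bt` is the adjoint of `B` -/
  hadj : ∀ u x : Mat d, trIP u (B x) = trIP (Bt u) x
  /-- `⟨B(x),u⟩ ≥ 0` whenever `x, u ∈ S_d^+` with `⟨x,u⟩ = 0` -/
  hBpos : ∀ x u : Mat d, x.PosSemidef → u.PosSemidef → trIP x u = 0 → 0 ≤ trIP (B x) u

/-- `ψ` solves the generalized Riccati equation `∂_t ψ(t,u) = R(ψ(t,u))`, `ψ(0,u) = u`,
staying in `S_d^+` for initial conditions in `S_d^+`. -/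
def IsRiccati (P : Admissible d) (ψ : ℝ → Mat d → Mat d) : Prop :=
  (∀ u : Mat d, u.PosSemidef → ψ 0 u = u) ∧
  (∀ t : ℝ, 0 ≤ t → ∀ u : Mat d, u.PosSemidef → (ψ t u).PosSemidef) ∧
  (∀ u : Mat d, u.PosSemidef → ∀ t ∈ Set.Ici (0 : ℝ),
    HasDerivWithinAt (fun s => ψ s u) (Rfun P.α P.Bt P.ν P.ρ (ψ t u)) (Set.Ici 0) t)

/-- `φ(t,u) = ∫_0^t F(ψ(s,u)) ds`. -/
def phiFun (P : Admissible d) (ψ : ℝ → Mat d → Mat d) (t : ℝ) (u : Mat d) : ℝ :=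
  ∫ s in (0 : ℝ)..t, Ffun P.b P.m (ψ s u)

/-- `p t x` is a family of Borel probability measures supported on `S_d^+` satisfying the
affine transform formula
`∫ e^{-⟨u,ξ⟩} p_t(x,dξ) = exp (-φ(t,u) - ⟨ψ(t,u),x⟩)`. -/
def IsAffineKernel (P : Admissible d) (ψ : ℝ → Mat d → Mat d)
    (p : ℝ → Mat d → Measure (Mat d)) : Prop :=
  (∀ t : ℝ, 0 ≤ t → ∀ x : Mat d, x.PosSemidef → IsProbabilityMeasure (p t x)) ∧
  (∀ t : ℝ, 0 ≤ t → ∀ x : Mat d, x.PosSemidef → p t x {ξ : Mat d | ¬ ξ.PosSemidef} = 0) ∧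
  (∀ t : ℝ, 0 ≤ t → ∀ u x : Mat d, u.PosSemidef → x.PosSemidef →
    ∫ ξ, Real.exp (-(trIP u ξ)) ∂(p t x) =
      Real.exp (-(phiFun P ψ t u) - trIP (ψ t u) x))

/-- `Bt2` is the effective drift `B̃(u) = B(u) + ∫_{S_d^+ \ {0}} ⟨ξ,u⟩ μ(dξ)`, given as a
(continuous) linear map so that its operator exponential can be formed. -/
def IsEffectiveDrift (P : Admissible d) (Bt2 : Mat d →L[ℝ] Mat d) : Prop :=
  ∀ u : Mat d, Bt2 u = P.B u + muInt P.ν P.ρ (fun ξ => trIP ξ u)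

/-- Weak convergence of `q t` to `π` as `t → ∞`: convergence of integrals of all bounded
continuous functions. -/
def WeakTendsto (q : ℝ → Measure (Mat d)) (π : Measure (Mat d)) : Prop :=
  ∀ f : BoundedContinuousFunction (Mat d) ℝ,
    Tendsto (fun t => ∫ ξ, f ξ ∂(q t)) atTop (𝓝 (∫ ξ, f ξ ∂π))

theorem aux_trIP_comm (x y : Mat d) : trIP x y = trIP y x := Matrix.trace_mul_comm x y

theorem aux_trIP_sum (x y : Mat d) : trIP x y = ∑ i, ∑ j, x i j * y j i := by
  simp [trIP, Matrix.trace, Matrix.mul_apply]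

/-- `trIP · y` as a continuous linear map. -/
def auxL (y : Mat d) : Mat d →L[ℝ] ℝ :=
  LinearMap.toContinuousLinearMap
    { toFun := fun x => trIP x y
      map_add' := by intro a b; simp [trIP, Matrix.add_mul]
      map_smul' := by intro a b; simp [trIP] }

theorem auxL_apply (y x : Mat d) : auxL y x = trIP x y := rfl

theorem aux_trIP_nonneg {x y : Mat d} (hx : x.PosSemidef) (hy : y.PosSemidef) :
    0 ≤ trIP x y := by
  have h := (hx.hadamard hy).dotProduct_mulVec_nonneg (fun _ => 1)
  rw [aux_trIP_sum]
  have hs : ∀ i j, y j i = y i j := fun i j => by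
    have := hy.1.apply i j
    simpa using this
  simp only [hs]
  simpa [dotProduct, mulVec] using h

theorem aux_entry {x : Mat d} (hx : x.PosSemidef) (i j : Fin d) :
    x i j ^ 2 ≤ x i i * x j j := by
  have h := (hx.submatrix ![i, j]).det_nonneg
  rw [Matrix.det_fin_two] at h
  have hs : x j i = x i j := by simpa using hx.1.apply i j
  simp [hs] at h
  nlinarith

theorem aux_norm_sq (x : Mat d) : ‖x‖ ^ 2 = ∑ i, ∑ j, x i j ^ 2 := by
  rw [Matrix.frobenius_norm_def]
  have h0 : 0 ≤ ∑ i, ∑ j, ‖x i j‖ ^ (2:ℝ) := by positivity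
  rw [← Real.sqrt_eq_rpow, Real.sq_sqrt h0]
  simp

theorem aux_norm_le_trace {x : Mat d} (hx : x.PosSemidef) : ‖x‖ ≤ x.trace := by
  apply le_of_sq_le_sq _ hx.trace_nonneg
  rw [aux_norm_sq, sq, Matrix.trace, Finset.sum_mul_sum]
  exact Finset.sum_le_sum fun i _ => Finset.sum_le_sum fun j _ => aux_entry hx i j

theorem aux_abs_entry (x : Mat d) (i j : Fin d) : |x i j| ≤ ‖x‖ := by
  refine abs_le_of_sq_le_sq ?_ (norm_nonneg _)
  rw [aux_norm_sq]
  exact le_trans (Finset.single_le_sum (f := fun j => x i j ^ 2) (fun _ _ => sq_nonneg _)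
      (Finset.mem_univ j))
    (Finset.single_le_sum (f := fun i => ∑ j, x i j ^ 2)
      (fun _ _ => Finset.sum_nonneg fun _ _ => sq_nonneg _) (Finset.mem_univ i))

theorem aux_entry_le_trace {x : Mat d} (hx : x.PosSemidef) (i j : Fin d) :
    |x i j| ≤ x.trace := by
  refine le_trans ?_ (aux_norm_le_trace hx)
  exact aux_abs_entry x i j

theorem aux_meas_entry (i j : Fin d) : Measurable (fun ξ : Mat d => ξ i j) := by
  have h : Measurable (fun ξ : Fin d → Fin d → ℝ => ξ i j) := by fun_prop
  exact h

theorem aux_meas_trIP (u : Mat d) : Measurable (fun ξ : Mat d => trIP u ξ) := by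
  simp only [aux_trIP_sum]
  exact Finset.measurable_sum _ fun i _ => Finset.measurable_sum _ fun j _ =>
    (aux_meas_entry j i).const_mul _

theorem aux_meas_cone : MeasurableSet (coneNZ d) := by
  have h1 : MeasurableSet {ξ : Fin d → Fin d → ℝ | (Matrix.of ξ).PosSemidef} := by
    apply IsClosed.measurableSet
    simp only [Matrix.posSemidef_iff_dotProduct_mulVec, Set.ofPred_and, Set.ofPred_forall]
    apply IsClosed.inter
    · simp only [Matrix.IsHermitian, ← Matrix.ext_iff, Set.ofPred_forall]
      refine isClosed_iInter fun i => isClosed_iInter fun j => ?_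
      simp only [Matrix.conjTranspose_apply, Matrix.of_apply]
      exact isClosed_eq (by simp; fun_prop) (by fun_prop)
    · refine isClosed_iInter fun v => ?_
      simp only [dotProduct, mulVec, Matrix.of_apply]
      exact isClosed_le (by fun_prop) (by fun_prop)
  have h2 : MeasurableSet {ξ : Fin d → Fin d → ℝ | ξ ≠ 0} :=
    (measurableSet_singleton (0 : Fin d → Fin d → ℝ)).compl
  exact h1.inter h2

theorem aux_exp_bound {C n t : ℝ} (ht : 0 ≤ t) (h : t ≤ C * n) :
    0 ≤ 1 - Real.exp (-t) ∧ 1 - Real.exp (-t) ≤ C * n ∧ 1 - Real.exp (-t) ≤ 1 := by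
  have h1 := Real.add_one_le_exp (-t)
  have h2 := Real.exp_pos (-t)
  have h3 : Real.exp (-t) ≤ 1 := Real.exp_le_one_iff.mpr (by linarith)
  refine ⟨by linarith, by linarith, by linarith⟩

/-- A crude bound for the functional `trIP u`. -/
def auxC (u : Mat d) : ℝ := ∑ i, ∑ j, |u i j|

theorem auxC_nonneg (u : Mat d) : 0 ≤ auxC u := by
  unfold auxC
  positivity

theorem aux_trIP_le (u ξ : Mat d) : trIP u ξ ≤ auxC u * ‖ξ‖ := by
  rw [aux_trIP_sum, auxC, Finset.sum_mul]
  refine Finset.sum_le_sum fun i _ => ?_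
  rw [Finset.sum_mul]
  refine Finset.sum_le_sum fun j _ => ?_
  refine (le_abs_self _).trans ?_
  rw [abs_mul]
  exact mul_le_mul_of_nonneg_left (aux_abs_entry ξ j i) (abs_nonneg _)

theorem aux_muInt (P : Admissible d) {v x : Mat d} (hv : v.PosSemidef) (hx : x.PosSemidef) :
    trIP (muInt P.ν P.ρ (fun ξ => Real.exp (-(trIP v ξ)) - 1)) x ≤ 0 := by
  have hint : ∀ i j, Integrable (fun ξ => (Real.exp (-(trIP v ξ)) - 1) * P.ρ ξ i j)
      (P.ν.restrict (coneNZ d)) := by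
    intro i j
    refine (P.hμint.const_mul (auxC v)).mono' ?_ ?_
    · exact ((((aux_meas_trIP v).neg.exp).sub_const 1).mul
        ((aux_meas_entry i j).comp P.hρmeas)).aestronglyMeasurable
    · filter_upwards [P.hρpsd, ae_restrict_mem aux_meas_cone] with ξ h1 h2
      obtain ⟨a1, a2, -⟩ := aux_exp_bound (aux_trIP_nonneg hv h2.1) (aux_trIP_le v ξ)
      rw [Real.norm_eq_abs, abs_mul, ← mul_assoc]
      refine mul_le_mul ?_ (aux_entry_le_trace h1 i j) (abs_nonneg _)
        (mul_nonneg (auxC_nonneg v) (norm_nonneg ξ))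
      rw [abs_sub_comm, abs_of_nonneg a1]
      exact a2
  have : trIP (muInt P.ν P.ρ (fun ξ => Real.exp (-(trIP v ξ)) - 1)) x
      = ∫ ξ in coneNZ d, (Real.exp (-(trIP v ξ)) - 1) * trIP (P.ρ ξ) x ∂P.ν := by
    simp only [aux_trIP_sum (P.ρ _) x, Finset.mul_sum, ← mul_assoc]
    rw [aux_trIP_sum, integral_finsetSum]
    · refine Finset.sum_congr rfl fun i _ => ?_
      rw [integral_finsetSum]
      · refine Finset.sum_congr rfl fun j _ => ?_
        rw [integral_mul_const]
        rfl
      · exact fun j _ => (hint i j).mul_const _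
    · exact fun i _ => integrable_finsetSum _ fun j _ => (hint i j).mul_const _
  rw [this]
  apply integral_nonpos_of_ae
  filter_upwards [P.hρpsd, ae_restrict_mem aux_meas_cone] with ξ h1 h2
  obtain ⟨a1, -, -⟩ := aux_exp_bound (aux_trIP_nonneg hv h2.1) (aux_trIP_le v ξ)
  exact mul_nonpos_of_nonpos_of_nonneg (by linarith) (aux_trIP_nonneg h1 hx)

theorem aux_lower (P : Admissible d) (ψ : ℝ → Mat d → Mat d) (hψ : IsRiccati P ψ)
    (hα0 : P.α = 0) (K : ℝ)
    (hKB : ∀ ξ : Mat d, ξ.PosSemidef → (K • ξ + P.B ξ).PosSemidef)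
    {u x : Mat d} (hu : u.PosSemidef) (hx : x.PosSemidef) {t : ℝ} (ht : 0 ≤ t) :
    Real.exp (-(K * t)) * trIP u x ≤ trIP (ψ t u) x := by
  obtain ⟨h0, hpsd, hder⟩ := hψ
  have hd : ∀ s ∈ Set.Ici (0:ℝ), HasDerivWithinAt
      (fun s => Real.exp (K * s) * trIP (ψ s u) x)
      (Real.exp (K * s) * (K * 1) * trIP (ψ s u) x +
        Real.exp (K * s) * trIP (Rfun P.α P.Bt P.ν P.ρ (ψ s u)) x) (Set.Ici 0) s := by
    intro s hs
    have e1 : HasDerivWithinAt (fun s : ℝ => Real.exp (K * s))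
        (Real.exp (K * s) * (K * 1)) (Set.Ici 0) s :=
      (((hasDerivAt_id s).const_mul K).exp).hasDerivWithinAt
    have e2 := (auxL x).hasFDerivAt.comp_hasDerivWithinAt s (hder u hu s hs)
    exact e1.mul e2
  have hmono : MonotoneOn (fun s => Real.exp (K * s) * trIP (ψ s u) x) (Set.Ici 0) := by
    refine monotoneOn_of_hasDerivWithinAt_nonneg (convex_Ici 0)
      (fun s hs => (hd s hs).continuousWithinAt)
      (fun s hs => (hd s (interior_subset hs)).mono interior_subset) ?_
    intro s hs
    have hs' : 0 ≤ s := interior_subset hs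
    have hp := hpsd s hs' u hu
    have k1 := aux_muInt P hp hx
    have k2 := aux_trIP_nonneg hp (hKB x hx)
    have k3 : trIP (ψ s u) (K • x + P.B x) = K * trIP (ψ s u) x + trIP (P.Bt (ψ s u)) x := by
      rw [← P.hadj]; simp [trIP, Matrix.mul_add]
    have k4 : trIP (Rfun P.α P.Bt P.ν P.ρ (ψ s u)) x = trIP (P.Bt (ψ s u)) x -
        trIP (muInt P.ν P.ρ (fun ξ => Real.exp (-(trIP (ψ s u) ξ)) - 1)) x := by
      simp [Rfun, hα0, trIP, Matrix.sub_mul]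
    rw [k4]
    have := Real.exp_pos (K * s)
    have : 0 ≤ Real.exp (K * s) * (K * trIP (ψ s u) x + (trIP (P.Bt (ψ s u)) x -
        trIP (muInt P.ν P.ρ (fun ξ => Real.exp (-(trIP (ψ s u) ξ)) - 1)) x)) :=
      mul_nonneg this.le (by linarith)
    linarith
  have := hmono (Set.mem_Ici.mpr le_rfl) (Set.mem_Ici.mpr ht) ht
  simp only [h0 u hu, mul_zero, Real.exp_zero, one_mul] at this
  calc Real.exp (-(K * t)) * trIP u x
      ≤ Real.exp (-(K * t)) * (Real.exp (K * t) * trIP (ψ t u) x) := by gcongr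
    _ = trIP (ψ t u) x := by rw [← mul_assoc, ← Real.exp_add]; simp

theorem aux_F_integrable (P : Admissible d) {v : Mat d} (hv : v.PosSemidef) :
    Integrable (fun ξ => 1 - Real.exp (-(trIP v ξ))) (P.m.restrict (coneNZ d)) := by
  refine (P.hm.const_mul (max (auxC v) 1)).mono' ?_ ?_
  · exact (((aux_meas_trIP v).neg.exp).const_sub 1).aestronglyMeasurable
  · filter_upwards [ae_restrict_mem aux_meas_cone] with ξ h2
    obtain ⟨a1, a2, a3⟩ := aux_exp_bound (aux_trIP_nonneg hv h2.1) (aux_trIP_le v ξ)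
    rw [Real.norm_of_nonneg a1]
    rcases min_choice ‖ξ‖ 1 with h | h <;> rw [h]
    · exact a2.trans (by gcongr; exact le_max_left _ _)
    · exact a3.trans (by simp)

theorem aux_main (P : Admissible d)
    (ψ : ℝ → Mat d → Mat d) (hψ : IsRiccati P ψ)
    (hα0 : P.α = 0)
    (K : ℝ) (hK : 0 < K)
    (hKB : ∀ ξ : Mat d, ξ.PosSemidef → (K • ξ + P.B ξ).PosSemidef)
    (u : Mat d) (hu : u.PosDef) :
      ∫⁻ ξ in coneNZ d ∩ {ξ : Mat d | 1 < trIP ξ u},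
          ENNReal.ofReal (Real.log (trIP ξ u)) ∂P.m ≤
        ENNReal.ofReal (K / (1 - Real.exp (-1))) *
          ∫⁻ s in Set.Ioi (0:ℝ), ENNReal.ofReal (Ffun P.b P.m (ψ s u)) := by
  have hm : Measurable (fun ξ : Mat d => trIP ξ u) := by
    simpa only [aux_trIP_comm u] using aux_meas_trIP u
  have hE : MeasurableSet (coneNZ d ∩ {ξ : Mat d | 1 < trIP ξ u}) :=
    aux_meas_cone.inter (measurableSet_lt measurable_const hm)
  have hml : Measurable (fun ξ : Mat d => Real.log (trIP ξ u) / K) := hm.log.div_const K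
  set E := coneNZ d ∩ {ξ : Mat d | 1 < trIP ξ u} with hEdef
  have hc : 0 < 1 - Real.exp (-1) := by
    have : Real.exp (-1) < 1 := by rw [Real.exp_lt_one_iff]; norm_num
    linarith
  have key : ∀ t ∈ Set.Ioi (0:ℝ),
      (P.m.restrict E) {ξ | t ≤ Real.log (trIP ξ u) / K} ≤
        ENNReal.ofReal (1 / (1 - Real.exp (-1))) * ENNReal.ofReal (Ffun P.b P.m (ψ t u)) := by
    intro t ht
    have ht0 : 0 ≤ t := le_of_lt ht
    have hp := hψ.2.1 t ht0 u hu.posSemidef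
    have hS : MeasurableSet {ξ : Mat d | t ≤ Real.log (trIP ξ u) / K} :=
      measurableSet_le measurable_const hml
    have f1 : ENNReal.ofReal (1 - Real.exp (-1)) *
        (P.m.restrict E) {ξ | t ≤ Real.log (trIP ξ u) / K} ≤
        ENNReal.ofReal (Ffun P.b P.m (ψ t u)) := by
      rw [Measure.restrict_apply hS, ← setLIntegral_const]
      calc _ ≤ ∫⁻ ξ in {ξ | t ≤ Real.log (trIP ξ u) / K} ∩ E,
              ENNReal.ofReal (1 - Real.exp (-(trIP (ψ t u) ξ))) ∂P.m := by
            refine setLIntegral_mono' (hS.inter hE) ?_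
            rintro ξ ⟨h1, h2, h3⟩
            apply ENNReal.ofReal_le_ofReal
            have h3' : 1 < trIP ξ u := h3
            have h1' : t ≤ Real.log (trIP ξ u) / K := h1
            rw [le_div_iff₀ hK] at h1'
            have g := aux_lower P ψ hψ hα0 K hKB hu.posSemidef h2.1 ht0
            have g2 : Real.exp (K * t) ≤ trIP u ξ := by
              rw [aux_trIP_comm u, ← Real.le_log_iff_exp_le (by linarith)]
              linarith
            have g3 : 1 ≤ Real.exp (-(K * t)) * trIP u ξ := by
              calc 1 = Real.exp (-(K * t)) * Real.exp (K * t) := by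
                    rw [← Real.exp_add]; simp
                _ ≤ _ := by gcongr
            have : Real.exp (-(trIP (ψ t u) ξ)) ≤ Real.exp (-1) :=
              Real.exp_le_exp.mpr (by linarith)
            linarith
        _ ≤ ∫⁻ ξ in coneNZ d, ENNReal.ofReal (1 - Real.exp (-(trIP (ψ t u) ξ))) ∂P.m :=
            lintegral_mono_set fun ξ h => h.2.1
        _ = ENNReal.ofReal (∫ ξ in coneNZ d, (1 - Real.exp (-(trIP (ψ t u) ξ))) ∂P.m) := by
            rw [ofReal_integral_eq_lintegral_ofReal (aux_F_integrable P hp)]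
            filter_upwards [ae_restrict_mem aux_meas_cone] with ξ h2
            exact (aux_exp_bound (aux_trIP_nonneg hp h2.1) (aux_trIP_le _ ξ)).1
        _ ≤ _ := by
            apply ENNReal.ofReal_le_ofReal
            have := aux_trIP_nonneg P.hb hp
            unfold Ffun
            linarith
    calc (P.m.restrict E) {ξ | t ≤ Real.log (trIP ξ u) / K}
        = ENNReal.ofReal (1 / (1 - Real.exp (-1))) * (ENNReal.ofReal (1 - Real.exp (-1)) *
          (P.m.restrict E) {ξ | t ≤ Real.log (trIP ξ u) / K}) := by
          rw [← mul_assoc, ← ENNReal.ofReal_mul (by positivity), one_div,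
            inv_mul_cancel₀ hc.ne']
          simp
      _ ≤ _ := by gcongr
  calc ∫⁻ ξ in E, ENNReal.ofReal (Real.log (trIP ξ u)) ∂P.m
      = ∫⁻ ξ in E, ENNReal.ofReal K * ENNReal.ofReal (Real.log (trIP ξ u) / K) ∂P.m := by
        refine lintegral_congr fun ξ => ?_
        rw [← ENNReal.ofReal_mul hK.le, mul_div_cancel₀ _ hK.ne']
    _ = ENNReal.ofReal K * ∫⁻ ξ in E, ENNReal.ofReal (Real.log (trIP ξ u) / K) ∂P.m :=
        lintegral_const_mul _ hml.ennreal_ofReal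
    _ = ENNReal.ofReal K * ∫⁻ t in Set.Ioi (0:ℝ),
          (P.m.restrict E) {ξ | t ≤ Real.log (trIP ξ u) / K} := by
        rw [lintegral_eq_lintegral_meas_le _ _ hml.aemeasurable]
        filter_upwards [ae_restrict_mem hE] with ξ h
        exact div_nonneg (Real.log_nonneg (le_of_lt h.2)) hK.le
    _ ≤ ENNReal.ofReal K * ∫⁻ t in Set.Ioi (0:ℝ), ENNReal.ofReal (1 / (1 - Real.exp (-1))) *
          ENNReal.ofReal (Ffun P.b P.m (ψ t u)) := by
        gcongr 1
        exact setLIntegral_mono' measurableSet_Ioi key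
    _ = _ := by
        rw [lintegral_const_mul' _ _ ENNReal.ofReal_ne_top, ← mul_assoc,
          ← ENNReal.ofReal_mul hK.le, mul_one_div]

/-- The key estimate in the proof of Proposition 2.5: if `α = 0` and `Kξ + B(ξ) ⪰ 0` on
`S_d^+` for some `K > 0`, then for every `u ∈ S_d^{++}`,
`∫_{⟨ξ,u⟩>1} log ⟨ξ,u⟩ m(dξ) ≤ (K / (1 - e^{-1})) ∫_0^∞ F(ψ(s,u)) ds`; in particular, taking
`u = 𝟙`, finiteness of `∫_0^∞ F(ψ(s,𝟙)) ds` implies `∫_{‖ξ‖>1} log ‖ξ‖ m(dξ) < ∞`. -/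
theorem log_moment_estimate
    (d : ℕ) (hd : 2 ≤ d) (P : Admissible d)
    (ψ : ℝ → Mat d → Mat d) (hψ : IsRiccati P ψ)
    (hα0 : P.α = 0)
    (K : ℝ) (hK : 0 < K)
    (hKB : ∀ ξ : Mat d, ξ.PosSemidef → (K • ξ + P.B ξ).PosSemidef) :
    (∀ u : Mat d, u.PosDef →
      ∫⁻ ξ in coneNZ d ∩ {ξ : Mat d | 1 < trIP ξ u},
          ENNReal.ofReal (Real.log (trIP ξ u)) ∂P.m ≤
        ENNReal.ofReal (K / (1 - Real.exp (-1))) *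
          ∫⁻ s in Set.Ioi (0:ℝ), ENNReal.ofReal (Ffun P.b P.m (ψ s u))) ∧
    ((∫⁻ s in Set.Ioi (0:ℝ), ENNReal.ofReal (Ffun P.b P.m (ψ s (1 : Mat d))) < ⊤) →
      ∫⁻ ξ in coneNZ d ∩ {ξ : Mat d | 1 < ‖ξ‖},
        ENNReal.ofReal (Real.log ‖ξ‖) ∂P.m < ⊤) := by
  have hmain := aux_main P ψ hψ hα0 K hK hKB
  refine ⟨hmain, fun hfin => ?_⟩
  have h1 := hmain 1 Matrix.PosDef.one
  refine lt_of_le_of_lt ?_ (lt_of_le_of_lt h1 (ENNReal.mul_lt_top ENNReal.ofReal_lt_top hfin))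
  have htr : ∀ ξ : Mat d, trIP ξ 1 = ξ.trace := fun ξ => by simp [trIP]
  have hm : Measurable (fun ξ : Mat d => trIP ξ 1) := by
    simpa only [aux_trIP_comm 1] using aux_meas_trIP (1 : Mat d)
  have hE : MeasurableSet (coneNZ d ∩ {ξ : Mat d | 1 < trIP ξ 1}) :=
    aux_meas_cone.inter (measurableSet_lt measurable_const hm)
  refine (lintegral_mono_set (t := coneNZ d ∩ {ξ : Mat d | 1 < trIP ξ 1}) ?_).trans
    (setLIntegral_mono' hE ?_)
  · rintro ξ ⟨h2, h3⟩
    refine ⟨h2, ?_⟩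
    have h3' : 1 < ‖ξ‖ := h3
    change 1 < trIP ξ 1
    rw [htr]
    exact lt_of_lt_of_le h3' (aux_norm_le_trace h2.1)
  · rintro ξ ⟨h2, h3⟩
    apply ENNReal.ofReal_le_ofReal
    rw [htr]
    exact Real.log_le_log (norm_pos_iff.mpr h2.2) (aux_norm_le_trace h2.1)
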